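/- For every continuous function U : [0,1] → ℝ there exists a point p ∈ [0,1] such that U(p)·(y − p) ≤ 0 for every y ∈ [0,1]. (Such a p can be chosen as follows: if U(q) > 0 for all q ∈ [0,1] take p = 1; if U(q) < 0 for all q ∈ [0,1] take p = 0; otherwise take p to be a root of U, which exists by the intermediate value theorem.) -/

import Mathlib

/-- One-step defensive forecasting lemma: for every continuous function
`U : [0,1] → ℝ` there is a forecast `p ∈ [0,1]` such that `U p * (y - p) ≤ 0`
for every outcome `y ∈ [0,1]`. -/
theorem stmt_0 (U : ℝ → ℝ) (hU : ContinuousOn U (Set.Icc (0:ℝ) 1)) :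
    ∃ p ∈ Set.Icc (0:ℝ) 1, ∀ y ∈ Set.Icc (0:ℝ) 1, U p * (y - p) ≤ 0 := by
  rcases le_or_gt (U 0) 0 with h0 | h0
  · exact ⟨0, by simp, fun y hy => mul_nonpos_of_nonpos_of_nonneg h0 (sub_nonneg.2 hy.1)⟩
  rcases le_or_gt 0 (U 1) with h1 | h1
  · exact ⟨1, by simp, fun y hy => mul_nonpos_of_nonneg_of_nonpos h1 (sub_nonpos.2 hy.2)⟩
  obtain ⟨p, hp, hUp⟩ := intermediate_value_Icc' zero_le_one hU ⟨h1.le, h0.le⟩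
  exact ⟨p, hp, fun y _ => by simp [hUp]⟩
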